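/- Let n ≥ 1, let g : ℝⁿ → (symmetric positive-definite n×n real matrices) be smooth, let ψ : ℝⁿ → ℝ be smooth and positive, and let γ : ℝ × [0,t₀) → ℝ^{1+n} be a curve shortening flow in local coordinates with respect to the left warped product metric G_L. If at a point (x,t) the angle function Θ_L = ⟨T, ∂r⟩_{G_L} satisfies Θ_L > 0, then at that point ∂_t Θ_L ≥ ΔΘ_L + (|A|²/2) Θ_L − 4|D(log ψ)|² Θ_L − 4 |D(log ψ)|² ψ² / Θ_L, where |D(log ψ)|² = Σ_{k,l} (g⁻¹)^{kl} ∂_k(log ψ) ∂_l(log ψ), and D(log ψ), |D(log ψ)|², ψ are evaluated at the ℝⁿ-component of γ(x,t). -/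

import Mathlib

open scoped BigOperators

noncomputable section

/-- Inner product of two vectors with respect to a metric matrix `G`. -/
def minner {m : ℕ} (G : Matrix (Fin m) (Fin m) ℝ) (u v : Fin m → ℝ) : ℝ :=
  ∑ α, ∑ β, u α * G α β * v β

/-- Norm of a vector with respect to a metric matrix `G`. -/
def mnorm {m : ℕ} (G : Matrix (Fin m) (Fin m) ℝ) (v : Fin m → ℝ) : ℝ :=
  Real.sqrt (minner G v v)

/-- Christoffel symbols `Γ^α_{βγ}` of the metric `G` at the point `p`:
`Γ^α_{βγ} = (1/2) Σ_δ (G⁻¹)^{αδ}(∂_β G_{δγ} + ∂_γ G_{δβ} − ∂_δ G_{βγ})`. -/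
def christoffel {m : ℕ} (G : (Fin m → ℝ) → Matrix (Fin m) (Fin m) ℝ)
    (p : Fin m → ℝ) (α β γ : Fin m) : ℝ :=
  (1 / 2) * ∑ δ, (G p)⁻¹ α δ *
      (fderiv ℝ (fun q => G q δ γ) p (Pi.single β 1)
        + fderiv ℝ (fun q => G q δ β) p (Pi.single γ 1)
        - fderiv ℝ (fun q => G q β γ) p (Pi.single δ 1))

/-- Unit tangent vector `T = ∂ₓc/|∂ₓc|_G` of a curve `c` with respect to the metric `G`. -/
def unitT {m : ℕ} (G : (Fin m → ℝ) → Matrix (Fin m) (Fin m) ℝ)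
    (c : ℝ → Fin m → ℝ) (x : ℝ) : Fin m → ℝ :=
  (mnorm (G (c x)) (deriv c x))⁻¹ • deriv c x

/-- Covariant derivative `∇_T V` of a vector field `V` along the curve `c`. -/
def covT {m : ℕ} (G : (Fin m → ℝ) → Matrix (Fin m) (Fin m) ℝ)
    (c V : ℝ → Fin m → ℝ) (x : ℝ) : Fin m → ℝ :=
  fun α => (mnorm (G (c x)) (deriv c x))⁻¹ *
    (deriv (fun y => V y α) x
      + ∑ β, ∑ δ, christoffel G (c x) α β δ * deriv c x β * V x δ)

/-- Mean curvature vector `H = ∇_T T` of the curve `c`. -/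
def meanCurv {m : ℕ} (G : (Fin m → ℝ) → Matrix (Fin m) (Fin m) ℝ)
    (c : ℝ → Fin m → ℝ) : ℝ → Fin m → ℝ :=
  covT G c (unitT G c)

/-- Directional derivative `T(η) = |∂ₓc|⁻¹ ∂ₓη` of a scalar function along the curve `c`. -/
def Tscal {m : ℕ} (G : (Fin m → ℝ) → Matrix (Fin m) (Fin m) ℝ)
    (c : ℝ → Fin m → ℝ) (η : ℝ → ℝ) (x : ℝ) : ℝ :=
  (mnorm (G (c x)) (deriv c x))⁻¹ * deriv η x

/-- Laplacian `Δη = T(T(η))` along the curve `c`. -/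
def lapScal {m : ℕ} (G : (Fin m → ℝ) → Matrix (Fin m) (Fin m) ℝ)
    (c : ℝ → Fin m → ℝ) (η : ℝ → ℝ) : ℝ → ℝ :=
  Tscal G c (Tscal G c η)

/-- Time covariant derivative `∇_t V` along a flow `γ`. -/
def covTime {m : ℕ} (G : (Fin m → ℝ) → Matrix (Fin m) (Fin m) ℝ)
    (γ V : ℝ → ℝ → Fin m → ℝ) (x t : ℝ) : Fin m → ℝ :=
  fun α => deriv (fun s => V x s α) t
    + ∑ β, ∑ δ, christoffel G (γ x t) α β δ * deriv (fun s => γ x s β) t * V x t δ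

/-- Left warped product metric `g + ψ²(x) dr²` on `ℝ^{1+n}` (index 0 is the circle direction). -/
def gwL {n : ℕ} (g : (Fin n → ℝ) → Matrix (Fin n) (Fin n) ℝ)
    (ψ : (Fin n → ℝ) → ℝ) (p : Fin (n + 1) → ℝ) : Matrix (Fin (n + 1)) (Fin (n + 1)) ℝ :=
  Matrix.of fun α β =>
    Fin.cases (Fin.cases ((ψ fun i => p i.succ) ^ 2) (fun _ => 0) β)
      (fun i => Fin.cases 0 (fun j => g (fun k => p k.succ) i j) β) α

/-- Right warped product metric `φ²(r) g + dr²` on `ℝ^{1+n}` (index 0 is the circle direction). -/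
def gwR {n : ℕ} (g : (Fin n → ℝ) → Matrix (Fin n) (Fin n) ℝ)
    (φ : ℝ → ℝ) (p : Fin (n + 1) → ℝ) : Matrix (Fin (n + 1)) (Fin (n + 1)) ℝ :=
  Matrix.of fun α β =>
    Fin.cases (Fin.cases 1 (fun _ => 0) β)
      (fun i => Fin.cases 0 (fun j => (φ (p 0)) ^ 2 * g (fun k => p k.succ) i j) β) α

/-- The vector `∂r = e₀` in `ℝ^{1+n}`. -/
def er (n : ℕ) : Fin (n + 1) → ℝ := Pi.single 0 1

/-- The gradient `D(log ψ)` of `log ψ` with respect to `(N, g)`, as a vector in `ℝ^{1+n}`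
with vanishing 0-th component. -/
def DlogPsi {n : ℕ} (g : (Fin n → ℝ) → Matrix (Fin n) (Fin n) ℝ)
    (ψ : (Fin n → ℝ) → ℝ) (x : Fin n → ℝ) : Fin (n + 1) → ℝ :=
  Fin.cases 0 (fun i => ∑ k, (g x)⁻¹ i k *
    fderiv ℝ (fun y => Real.log (ψ y)) x (Pi.single k 1))

/-- `|D(log ψ)|² = Σ_{k,l} (g⁻¹)^{kl} ∂_k(log ψ) ∂_l(log ψ)`. -/
def normSqDlogPsi {n : ℕ} (g : (Fin n → ℝ) → Matrix (Fin n) (Fin n) ℝ)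
    (ψ : (Fin n → ℝ) → ℝ) (x : Fin n → ℝ) : ℝ :=
  ∑ k, ∑ l, (g x)⁻¹ k l *
    fderiv ℝ (fun y => Real.log (ψ y)) x (Pi.single k 1) *
    fderiv ℝ (fun y => Real.log (ψ y)) x (Pi.single l 1)

/-- `∇_X ∂r` at the point `p`, i.e. `(∇_X ∂r)^α = Σ_β X^β Γ^α_{β0}`. -/
def covR {m : ℕ} [NeZero m] (G : (Fin m → ℝ) → Matrix (Fin m) (Fin m) ℝ)
    (p : Fin m → ℝ) (X : Fin m → ℝ) : Fin m → ℝ :=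
  fun α => ∑ β, X β * christoffel G p α β 0

/-- The angle function `Θ_L = ⟨T, ∂r⟩_{G_L}` of a flow `γ` in the left warped product. -/
def thetaL {n : ℕ} (g : (Fin n → ℝ) → Matrix (Fin n) (Fin n) ℝ)
    (ψ : (Fin n → ℝ) → ℝ) (γ : ℝ → ℝ → Fin (n + 1) → ℝ) (x t : ℝ) : ℝ :=
  minner (gwL g ψ (γ x t)) (unitT (gwL g ψ) (fun y => γ y t) x) (er n)

/-- The angle function `Θ_R = ⟨T, ∂r⟩_{G_R}` of a flow `γ` in the right warped product. -/
def thetaR {n : ℕ} (g : (Fin n → ℝ) → Matrix (Fin n) (Fin n) ℝ)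
    (φ : ℝ → ℝ) (γ : ℝ → ℝ → Fin (n + 1) → ℝ) (x t : ℝ) : ℝ :=
  minner (gwR g φ (γ x t)) (unitT (gwR g φ) (fun y => γ y t) x) (er n)

section Bilinear

variable {m : ℕ} (M : Matrix (Fin m) (Fin m) ℝ)

lemma minner_eq_dotProduct (u v : Fin m → ℝ) : minner M u v = u ⬝ᵥ M.mulVec v := by
  simp only [minner, dotProduct, Matrix.mulVec, Finset.mul_sum, mul_assoc]

lemma minner_add_left (u v w : Fin m → ℝ) :
    minner M (u + v) w = minner M u w + minner M v w := by
  simp only [minner_eq_dotProduct, add_dotProduct]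

lemma minner_smul_left (a : ℝ) (u w : Fin m → ℝ) :
    minner M (a • u) w = a * minner M u w := by
  simp only [minner_eq_dotProduct, smul_dotProduct, smul_eq_mul]

lemma minner_smul_right (a : ℝ) (u w : Fin m → ℝ) :
    minner M u (a • w) = a * minner M u w := by
  simp only [minner_eq_dotProduct, Matrix.mulVec_smul, dotProduct_smul, smul_eq_mul]

variable {M}

lemma minner_comm (hM : ∀ i j, M i j = M j i) (u v : Fin m → ℝ) :
    minner M u v = minner M v u := by
  unfold minner
  rw [Finset.sum_comm]
  refine Finset.sum_congr rfl fun i _ => Finset.sum_congr rfl fun j _ => ?_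
  rw [hM j i]; ring

lemma Matrix.PosDef.apply_comm (hM : M.PosDef) (i j : Fin m) : M i j = M j i := by
  simpa using hM.isHermitian.apply j i

lemma Matrix.PosDef.minner_pos (hM : M.PosDef) {u : Fin m → ℝ} (hu : u ≠ 0) :
    0 < minner M u u := by
  rw [minner_eq_dotProduct]
  simpa using hM.dotProduct_mulVec_pos hu

lemma Matrix.PosDef.minner_nonneg (hM : M.PosDef) (u : Fin m → ℝ) : 0 ≤ minner M u u := by
  rw [minner_eq_dotProduct]
  simpa using hM.posSemidef.dotProduct_mulVec_nonneg u

/-- The Cauchy–Schwarz inequality for a positive definite matrix. -/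
lemma Matrix.PosDef.sq_minner_le (hM : M.PosDef) (u v : Fin m → ℝ) :
    minner M u v ^ 2 ≤ minner M u u * minner M v v := by
  have h : ∀ s : ℝ, 0 ≤ minner M v v * (s * s) + 2 * minner M u v * s + minner M u u := by
    intro s
    have h := hM.minner_nonneg (u + s • v)
    rw [minner_add_left, minner_smul_left, minner_comm hM.apply_comm u,
      minner_comm hM.apply_comm v, minner_add_left, minner_add_left, minner_smul_left,
      minner_smul_left, minner_comm hM.apply_comm v u] at h
    linarith
  have := discrim_le_zero h
  unfold discrim at this
  nlinarith

/-- The Cauchy–Schwarz inequality between a vector and a covector. -/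
lemma Matrix.PosDef.sq_dotProduct_le (hM : M.PosDef) (u ξ : Fin m → ℝ) :
    (u ⬝ᵥ ξ) ^ 2 ≤ minner M⁻¹ ξ ξ * minner M u u := by
  have hdet : IsUnit M.det := hM.det_pos.ne'.isUnit
  have h := hM.sq_minner_le u (M⁻¹.mulVec ξ)
  have h1 : M.mulVec (M⁻¹.mulVec ξ) = ξ := by
    rw [Matrix.mulVec_mulVec, Matrix.mul_nonsing_inv _ hdet, Matrix.one_mulVec]
  rw [minner_eq_dotProduct M u, minner_eq_dotProduct M (M⁻¹.mulVec ξ), h1] at h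
  rw [minner_eq_dotProduct M⁻¹, dotProduct_comm ξ]
  linarith

end Bilinear

section Metric

variable {m : ℕ}

/-- The entrywise derivative of the metric `G` at `p` in the direction `X`. -/
def metricDeriv (G : (Fin m → ℝ) → Matrix (Fin m) (Fin m) ℝ) (p X : Fin m → ℝ) :
    Matrix (Fin m) (Fin m) ℝ :=
  Matrix.of fun α β => fderiv ℝ (fun q => G q α β) p X

variable {G : (Fin m → ℝ) → Matrix (Fin m) (Fin m) ℝ}

lemma fderiv_apply_eq_sum (f : (Fin m → ℝ) → ℝ) (p X : Fin m → ℝ) :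
    fderiv ℝ f p X = ∑ i, X i * fderiv ℝ f p (Pi.single i 1) := by
  conv_lhs => rw [pi_eq_sum_univ' X]
  rw [map_sum]
  refine Finset.sum_congr rfl fun i _ => ?_
  rw [map_smul, smul_eq_mul]

lemma hasDerivAt_minner (hG : ∀ i j, Differentiable ℝ fun p => G p i j)
    {c u w : ℝ → Fin m → ℝ} {c' u' w' : Fin m → ℝ} {x : ℝ}
    (hc : HasDerivAt c c' x) (hu : HasDerivAt u u' x) (hw : HasDerivAt w w' x) :
    HasDerivAt (fun y => minner (G (c y)) (u y) (w y))
      (minner (G (c x)) u' (w x) + minner (G (c x)) (u x) w'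
        + minner (metricDeriv G (c x) c') (u x) (w x)) x := by
  have hu := hasDerivAt_pi.1 hu
  have hw := hasDerivAt_pi.1 hw
  have h : ∀ α β, HasDerivAt (fun y => u y α * G (c y) α β * w y β)
      ((u' α * G (c x) α β + u x α * fderiv ℝ (fun q => G q α β) (c x) c') * w x β
        + u x α * G (c x) α β * w' β) x := fun α β =>
    ((hu α).mul ((hG α β (c x)).hasFDerivAt.comp_hasDerivAt x hc)).mul (hw β)
  have h2 := HasDerivAt.fun_sum (u := Finset.univ) fun α _ =>
    HasDerivAt.fun_sum (u := Finset.univ) fun β _ => h α β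
  unfold minner
  refine h2.congr_deriv ?_
  simp only [← Finset.sum_add_distrib, metricDeriv, Matrix.of_apply]
  refine Finset.sum_congr rfl fun i _ => Finset.sum_congr rfl fun j _ => ?_
  ring

lemma sum_christoffel_mul {p : Fin m → ℝ} (hGp : (G p).PosDef) (β γ δ : Fin m) :
    ∑ α, christoffel G p α β γ * G p α δ
      = (1 / 2) * (fderiv ℝ (fun q => G q δ γ) p (Pi.single β 1)
        + fderiv ℝ (fun q => G q δ β) p (Pi.single γ 1)
        - fderiv ℝ (fun q => G q β γ) p (Pi.single δ 1)) := by
  have hdet : IsUnit (G p).det := hGp.det_pos.ne'.isUnit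
  set f : Fin m → ℝ := fun δ => fderiv ℝ (fun q => G q δ γ) p (Pi.single β 1)
        + fderiv ℝ (fun q => G q δ β) p (Pi.single γ 1)
        - fderiv ℝ (fun q => G q β γ) p (Pi.single δ 1) with hf
  have h : (G p).mulVec ((G p)⁻¹.mulVec f) = f := by
    rw [Matrix.mulVec_mulVec, Matrix.mul_nonsing_inv _ hdet, Matrix.one_mulVec]
  calc ∑ α, christoffel G p α β γ * G p α δ
      = (1 / 2) * (G p).mulVec ((G p)⁻¹.mulVec f) δ := by
        simp only [christoffel, Matrix.mulVec, dotProduct, hf]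
        rw [Finset.mul_sum]
        refine Finset.sum_congr rfl fun α _ => ?_
        rw [hGp.apply_comm δ α]; ring
    _ = _ := by rw [h]

/-- The Christoffel contribution to `⟨∇_X X, w⟩`, in terms of derivatives of the metric. -/
lemma sum_christoffel_minner (hG : ∀ p, (G p).PosDef) (p X w : Fin m → ℝ) :
    minner (G p) (fun α => ∑ β, ∑ δ, christoffel G p α β δ * X β * X δ) w
      = minner (metricDeriv G p X) X w - (1 / 2) * minner (metricDeriv G p w) X X := by
  set D : Fin m → Fin m → Fin m → ℝ :=
    fun a i j => fderiv ℝ (fun q => G q i j) p (Pi.single a 1) with hD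
  have hDs : ∀ a i j, D a i j = D a j i := by
    intro a i j
    simp only [hD]
    congr 2
    ext q
    exact (hG q).apply_comm i j
  have hL : minner (G p) (fun α => ∑ β, ∑ δ, christoffel G p α β δ * X β * X δ) w
      = ∑ δ, ∑ β, ∑ γ, (1 / 2) * (D β δ γ + D γ δ β - D δ β γ) * X β * X γ * w δ := by
    unfold minner
    rw [Finset.sum_comm]
    refine Finset.sum_congr rfl fun δ _ => ?_
    simp only [Finset.sum_mul]
    rw [Finset.sum_comm]
    refine Finset.sum_congr rfl fun β _ => ?_
    rw [Finset.sum_comm]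
    refine Finset.sum_congr rfl fun γ _ => ?_
    have := sum_christoffel_mul (hG p) β γ δ
    simp only [hD]
    rw [← this, Finset.sum_mul, Finset.sum_mul, Finset.sum_mul]
    refine Finset.sum_congr rfl fun α _ => ?_
    ring
  have hA : minner (metricDeriv G p X) X w
      = ∑ δ, ∑ β, ∑ γ, D β δ γ * X β * X γ * w δ := by
    simp only [minner, metricDeriv, Matrix.of_apply]
    rw [Finset.sum_comm]
    refine Finset.sum_congr rfl fun δ _ => ?_
    rw [Finset.sum_comm]
    refine Finset.sum_congr rfl fun γ _ => ?_
    rw [fderiv_apply_eq_sum, Finset.mul_sum, Finset.sum_mul]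
    refine Finset.sum_congr rfl fun β _ => ?_
    rw [hDs β δ γ]
    ring
  have hB : minner (metricDeriv G p w) X X
      = ∑ δ, ∑ β, ∑ γ, D δ β γ * X β * X γ * w δ := by
    simp only [minner, metricDeriv, Matrix.of_apply]
    conv_rhs => rw [Finset.sum_comm]
    refine Finset.sum_congr rfl fun β _ => ?_
    conv_rhs => rw [Finset.sum_comm]
    refine Finset.sum_congr rfl fun γ _ => ?_
    rw [fderiv_apply_eq_sum, Finset.mul_sum, Finset.sum_mul]
    refine Finset.sum_congr rfl fun δ _ => ?_
    ring
  have hA' : minner (metricDeriv G p X) X w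
      = ∑ δ, ∑ β, ∑ γ, D γ δ β * X β * X γ * w δ := by
    rw [hA]
    refine Finset.sum_congr rfl fun δ _ => ?_
    rw [Finset.sum_comm]
    refine Finset.sum_congr rfl fun γ _ => Finset.sum_congr rfl fun β _ => ?_
    ring
  have : minner (metricDeriv G p X) X w = (1 / 2) * minner (metricDeriv G p X) X w
    + (1 / 2) * minner (metricDeriv G p X) X w := by ring
  rw [this, hL, hB]
  nth_rw 1 [hA]
  rw [hA']
  simp only [Finset.mul_sum, ← Finset.sum_add_distrib, ← Finset.sum_sub_distrib]
  refine Finset.sum_congr rfl fun δ _ => Finset.sum_congr rfl fun β _ =>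
    Finset.sum_congr rfl fun γ _ => ?_
  ring

lemma mnorm_pos {M : Matrix (Fin m) (Fin m) ℝ} (hM : M.PosDef) {u : Fin m → ℝ} (hu : u ≠ 0) :
    0 < mnorm M u :=
  Real.sqrt_pos.2 (hM.minner_pos hu)

lemma mnorm_sq {M : Matrix (Fin m) (Fin m) ℝ} (hM : M.PosDef) (u : Fin m → ℝ) :
    mnorm M u ^ 2 = minner M u u :=
  Real.sq_sqrt (hM.minner_nonneg u)

lemma hasDerivAt_mnorm (hG : ∀ i j, Differentiable ℝ fun p => G p i j)
    (hGp : ∀ p, (G p).PosDef) {c u : ℝ → Fin m → ℝ} {c' u' : Fin m → ℝ} {x : ℝ}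
    (hc : HasDerivAt c c' x) (hu : HasDerivAt u u' x) (hne : u x ≠ 0) :
    HasDerivAt (fun y => mnorm (G (c y)) (u y))
      ((mnorm (G (c x)) (u x))⁻¹ * (minner (G (c x)) (u x) u'
        + (1 / 2) * minner (metricDeriv G (c x) c') (u x) (u x))) x := by
  have h := (hasDerivAt_minner hG hc hu hu).sqrt ((hGp (c x)).minner_pos hne).ne'
  refine h.congr_deriv ?_
  have hp := mnorm_pos (hGp (c x)) hne
  rw [minner_comm (hGp (c x)).apply_comm u']
  change _ / (2 * mnorm (G (c x)) (u x)) = _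
  field_simp
  ring

lemma differentiable_unitT (hG : ∀ i j, Differentiable ℝ fun p => G p i j)
    (hGp : ∀ p, (G p).PosDef) {c : ℝ → Fin m → ℝ} (hc : Differentiable ℝ c)
    (hc' : Differentiable ℝ (deriv c)) (hne : ∀ x, deriv c x ≠ 0) :
    Differentiable ℝ (unitT G c) := fun x =>
  ((hasDerivAt_mnorm hG hGp (hc x).hasDerivAt (hc' x).hasDerivAt
    (hne x)).differentiableAt.inv (mnorm_pos (hGp (c x)) (hne x)).ne').smul (hc' x)

lemma minner_unitT_self (hGp : ∀ p, (G p).PosDef) {c : ℝ → Fin m → ℝ} {x : ℝ}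
    (hne : deriv c x ≠ 0) : minner (G (c x)) (unitT G c x) (unitT G c x) = 1 := by
  have hp := mnorm_pos (hGp (c x)) hne
  rw [unitT, minner_smul_left, minner_smul_right, ← mnorm_sq (hGp (c x))]
  field_simp

/-- The mean curvature vector tested against a vector `w`, without Christoffel symbols. -/
lemma minner_meanCurv (hGp : ∀ p, (G p).PosDef) {c : ℝ → Fin m → ℝ} {x : ℝ}
    (hT : DifferentiableAt ℝ (unitT G c) x) (w : Fin m → ℝ) :
    minner (G (c x)) (meanCurv G c x) w
      = (mnorm (G (c x)) (deriv c x))⁻¹ * (minner (G (c x)) (deriv (unitT G c) x) w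
        + minner (metricDeriv G (c x) (deriv c x)) (unitT G c x) w
        - (1 / 2) * minner (metricDeriv G (c x) w) (deriv c x) (unitT G c x)) := by
  set a := (mnorm (G (c x)) (deriv c x))⁻¹ with ha
  have hT' : ∀ α, deriv (fun y => unitT G c y α) x = deriv (unitT G c) x α := fun α =>
    (hasDerivAt_pi.1 hT.hasDerivAt α).deriv
  have hH : meanCurv G c x = a • (deriv (unitT G c) x + a • fun α =>
      ∑ β, ∑ δ, christoffel G (c x) α β δ * deriv c x β * deriv c x δ) := by
    ext α
    simp only [meanCurv, covT, hT', Pi.smul_apply, Pi.add_apply, smul_eq_mul, Finset.mul_sum]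
    congr 2
    refine Finset.sum_congr rfl fun β _ => Finset.sum_congr rfl fun δ _ => ?_
    simp only [unitT, Pi.smul_apply, smul_eq_mul, ← ha]
    ring
  rw [hH, minner_smul_left, minner_add_left, minner_smul_left, sum_christoffel_minner hGp]
  simp only [unitT, minner_smul_left, minner_smul_right, ← ha]
  ring

/-- The mean curvature vector is orthogonal to the curve. -/
lemma minner_meanCurv_unitT (hG : ∀ i j, Differentiable ℝ fun p => G p i j)
    (hGp : ∀ p, (G p).PosDef) {c : ℝ → Fin m → ℝ} (hc : Differentiable ℝ c)
    (hT : Differentiable ℝ (unitT G c)) (hne : ∀ x, deriv c x ≠ 0) (x : ℝ) :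
    minner (G (c x)) (meanCurv G c x) (unitT G c x) = 0 := by
  have h := hasDerivAt_minner hG (hc x).hasDerivAt (hT x).hasDerivAt (hT x).hasDerivAt
  have h1 : (fun y => minner (G (c y)) (unitT G c y) (unitT G c y)) = fun _ => 1 :=
    funext fun y => minner_unitT_self hGp (hne y)
  rw [h1] at h
  have h0 := h.unique (hasDerivAt_const x 1)
  rw [minner_comm (hGp (c x)).apply_comm (unitT G c x)] at h0
  rw [minner_meanCurv hGp (hT x)]
  have hu : metricDeriv G (c x) (unitT G c x)
      = (mnorm (G (c x)) (deriv c x))⁻¹ • metricDeriv G (c x) (deriv c x) := by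
    ext i j
    simp [metricDeriv, unitT]
  have hs : minner (metricDeriv G (c x) (unitT G c x)) (deriv c x) (unitT G c x)
      = minner (metricDeriv G (c x) (deriv c x)) (unitT G c x) (unitT G c x) := by
    rw [hu, minner_eq_dotProduct, Matrix.smul_mulVec, dotProduct_smul, smul_eq_mul,
      ← minner_eq_dotProduct, ← minner_smul_left]
    rfl
  rw [hs]
  linear_combination (mnorm (G (c x)) (deriv c x))⁻¹ / 2 * h0

lemma minner_meanCurv_self (hG : ∀ i j, Differentiable ℝ fun p => G p i j)
    (hGp : ∀ p, (G p).PosDef) {c : ℝ → Fin m → ℝ} (hc : Differentiable ℝ c)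
    (hT : Differentiable ℝ (unitT G c)) (hne : ∀ x, deriv c x ≠ 0) {x : ℝ} {H' : Fin m → ℝ}
    (hH : HasDerivAt (meanCurv G c) H' x) :
    minner (G (c x)) (deriv c x) H'
        + (1 / 2) * minner (metricDeriv G (c x) (meanCurv G c x)) (deriv c x) (deriv c x)
      = -(mnorm (G (c x)) (deriv c x)) ^ 2
        * minner (G (c x)) (meanCurv G c x) (meanCurv G c x) := by
  have h := hasDerivAt_minner hG (hc x).hasDerivAt (hT x).hasDerivAt hH
  have h1 : (fun y => minner (G (c y)) (unitT G c y) (meanCurv G c y)) = fun _ => 0 :=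
    funext fun y => by
      rw [minner_comm (hGp (c y)).apply_comm, minner_meanCurv_unitT hG hGp hc hT hne]
  rw [h1] at h
  have h0 := h.unique (hasDerivAt_const x 0)
  have hp := mnorm_pos (hGp (c x)) (hne x)
  have hm := minner_meanCurv hGp (hT x) (meanCurv G c x)
  have e1 : minner (G (c x)) (deriv c x) H'
      = mnorm (G (c x)) (deriv c x) * minner (G (c x)) (unitT G c x) H' := by
    rw [unitT, minner_smul_left]; field_simp
  have e2 : minner (metricDeriv G (c x) (meanCurv G c x)) (deriv c x) (deriv c x)
      = mnorm (G (c x)) (deriv c x)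
        * minner (metricDeriv G (c x) (meanCurv G c x)) (deriv c x) (unitT G c x) := by
    rw [unitT, minner_smul_right]; field_simp
  rw [e1, e2, hm]
  field_simp
  linear_combination 2 * h0

/-- Along a curve shortening flow, `∂_t |∂ₓγ| = -|A|² |∂ₓγ|`. -/
lemma hasDerivAt_speed (hG : ∀ i j, Differentiable ℝ fun p => G p i j)
    (hGp : ∀ p, (G p).PosDef) {γ : ℝ → ℝ → Fin m → ℝ} {x t : ℝ} {H' : Fin m → ℝ}
    (hc : Differentiable ℝ fun y => γ y t) (hT : Differentiable ℝ (unitT G fun y => γ y t))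
    (hne : ∀ y, deriv (fun y => γ y t) y ≠ 0)
    (hγ : HasDerivAt (γ x) (meanCurv G (fun y => γ y t) x) t)
    (hV : HasDerivAt (fun s => deriv (fun y => γ y s) x) H' t)
    (hH : HasDerivAt (meanCurv G fun y => γ y t) H' x) :
    HasDerivAt (fun s => mnorm (G (γ x s)) (deriv (fun y => γ y s) x))
      (-mnorm (G (γ x t)) (deriv (fun y => γ y t) x)
        * minner (G (γ x t)) (meanCurv G (fun y => γ y t) x)
          (meanCurv G (fun y => γ y t) x)) t := by
  refine (hasDerivAt_mnorm hG hGp hγ hV (hne x)).congr_deriv ?_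
  have h := minner_meanCurv_self hG hGp hc hT hne hH
  have hp := mnorm_pos (hGp (γ x t)) (hne x)
  rw [h]
  field_simp

end Metric

section WarpedProduct

variable {n : ℕ} {g : (Fin n → ℝ) → Matrix (Fin n) (Fin n) ℝ} {ψ : (Fin n → ℝ) → ℝ}

/-- The projection of `ℝ^{1+n}` onto its last `n` coordinates. -/
def tailCLM (n : ℕ) : (Fin (n + 1) → ℝ) →L[ℝ] (Fin n → ℝ) :=
  ContinuousLinearMap.pi fun i => ContinuousLinearMap.proj i.succ

lemma tailCLM_apply (p : Fin (n + 1) → ℝ) : tailCLM n p = fun i => p i.succ := rfl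

lemma tailCLM_er : tailCLM n (er n) = 0 := by
  ext i
  simp [tailCLM_apply, er]

lemma gwL_entry_eq_comp (hg : ∀ i j, ContDiff ℝ (⊤ : ℕ∞) fun x => g x i j)
    (hψ : ContDiff ℝ (⊤ : ℕ∞) ψ) (α β : Fin (n + 1)) :
    ∃ f : (Fin n → ℝ) → ℝ, ContDiff ℝ (⊤ : ℕ∞) f ∧
      (fun p => gwL g ψ p α β) = fun p => f (tailCLM n p) := by
  refine Fin.cases ?_ (fun i => ?_) α <;> refine Fin.cases ?_ (fun j => ?_) β
  · exact ⟨fun x => ψ x ^ 2, hψ.pow 2, rfl⟩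
  · exact ⟨fun _ => 0, contDiff_const, rfl⟩
  · exact ⟨fun _ => 0, contDiff_const, rfl⟩
  · exact ⟨fun x => g x i j, hg i j, rfl⟩

lemma differentiable_gwL (hg : ∀ i j, ContDiff ℝ (⊤ : ℕ∞) fun x => g x i j)
    (hψ : ContDiff ℝ (⊤ : ℕ∞) ψ) (α β : Fin (n + 1)) :
    Differentiable ℝ fun p => gwL g ψ p α β := by
  obtain ⟨f, hf, h⟩ := gwL_entry_eq_comp hg hψ α β
  rw [h]
  exact (hf.differentiable (by simp)).comp (tailCLM n).differentiable

lemma metricDeriv_gwL_er (hg : ∀ i j, ContDiff ℝ (⊤ : ℕ∞) fun x => g x i j)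
    (hψ : ContDiff ℝ (⊤ : ℕ∞) ψ) (p : Fin (n + 1) → ℝ) :
    metricDeriv (gwL g ψ) p (er n) = 0 := by
  ext α β
  obtain ⟨f, hf, h⟩ := gwL_entry_eq_comp hg hψ α β
  have hd := ((hf.differentiable (by simp)) (tailCLM n p)).hasFDerivAt.comp p
    (tailCLM n).hasFDerivAt
  simp only [metricDeriv, Matrix.of_apply, h]
  change fderiv ℝ (f ∘ tailCLM n) p (er n) = 0
  rw [hd.fderiv, ContinuousLinearMap.comp_apply, tailCLM_er, map_zero]

lemma minner_gwL (p u w : Fin (n + 1) → ℝ) :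
    minner (gwL g ψ p) u w = ψ (tailCLM n p) ^ 2 * u 0 * w 0
      + minner (g (tailCLM n p)) (tailCLM n u) (tailCLM n w) := by
  simp only [minner, gwL, Fin.sum_univ_succ, tailCLM_apply, Matrix.of_apply, Fin.cases_zero,
    Fin.cases_succ, mul_zero, zero_mul, Finset.sum_const_zero, add_zero, zero_add]
  ring

lemma minner_gwL_er (p u : Fin (n + 1) → ℝ) :
    minner (gwL g ψ p) u (er n) = ψ (tailCLM n p) ^ 2 * u 0 := by
  rw [minner_gwL, tailCLM_er, minner_eq_dotProduct, Matrix.mulVec_zero, dotProduct_zero]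
  simp [er]

lemma posDef_gwL (hgpd : ∀ x, (g x).PosDef) (hψpos : ∀ x, 0 < ψ x) (p : Fin (n + 1) → ℝ) :
    (gwL g ψ p).PosDef := by
  refine Matrix.PosDef.of_dotProduct_mulVec_pos ?_ fun u hu => ?_
  · ext α β
    rw [Matrix.conjTranspose_apply, star_trivial]
    refine Fin.cases ?_ (fun i => ?_) α <;> refine Fin.cases ?_ (fun j => ?_) β
    · rfl
    · rfl
    · rfl
    · exact (hgpd _).apply_comm j i
  · rw [star_trivial, ← minner_eq_dotProduct, minner_gwL]
    have hψ := hψpos (tailCLM n p)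
    have hn := (hgpd (tailCLM n p)).minner_nonneg (tailCLM n u)
    by_cases h0 : u 0 = 0
    · have ht : tailCLM n u ≠ 0 := by
        intro ht
        refine hu (funext fun α => Fin.cases h0 (fun i => ?_) α)
        exact congrFun ht i
      have := (hgpd (tailCLM n p)).minner_pos ht
      rw [h0]
      linarith
    · have : 0 < ψ (tailCLM n p) ^ 2 * u 0 * u 0 := by
        rw [mul_assoc]
        have := mul_self_pos.2 h0
        positivity
      linarith

lemma fderiv_log_apply (hψ : ContDiff ℝ (⊤ : ℕ∞) ψ) (hψpos : ∀ x, 0 < ψ x)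
    (x X : Fin n → ℝ) :
    fderiv ℝ (fun y => Real.log (ψ y)) x X = (ψ x)⁻¹ * fderiv ℝ ψ x X := by
  rw [fderiv.log (hψ.differentiable (by simp) x) (hψpos x).ne']
  rfl

lemma normSqDlogPsi_eq_minner (x : Fin n → ℝ) :
    normSqDlogPsi g ψ x = minner (g x)⁻¹
      (fun k => fderiv ℝ (fun y => Real.log (ψ y)) x (Pi.single k 1))
      (fun k => fderiv ℝ (fun y => Real.log (ψ y)) x (Pi.single k 1)) := by
  unfold normSqDlogPsi minner
  refine Finset.sum_congr rfl fun k _ => Finset.sum_congr rfl fun l _ => ?_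
  ring

lemma normSqDlogPsi_nonneg (hgpd : ∀ x, (g x).PosDef) (x : Fin n → ℝ) :
    0 ≤ normSqDlogPsi g ψ x := by
  rw [normSqDlogPsi_eq_minner]
  exact (hgpd x).inv.minner_nonneg _

/-- `(d log ψ (X))² ≤ |D(log ψ)|² |X|²`. -/
lemma sq_fderiv_log_le (hgpd : ∀ x, (g x).PosDef) (p X : Fin (n + 1) → ℝ) :
    (fderiv ℝ (fun y => Real.log (ψ y)) (tailCLM n p) (tailCLM n X)) ^ 2
      ≤ normSqDlogPsi g ψ (tailCLM n p) * minner (gwL g ψ p) X X := by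
  have h := (hgpd (tailCLM n p)).sq_dotProduct_le (tailCLM n X)
    (fun k => fderiv ℝ (fun y => Real.log (ψ y)) (tailCLM n p) (Pi.single k 1))
  rw [← normSqDlogPsi_eq_minner] at h
  rw [fderiv_apply_eq_sum]
  refine h.trans (mul_le_mul_of_nonneg_left ?_ (normSqDlogPsi_nonneg hgpd _))
  rw [minner_gwL, mul_assoc]
  have := mul_self_nonneg (X 0)
  nlinarith [sq_nonneg (ψ (tailCLM n p))]

/-- The angle function satisfies `T(Θ_L) = ⟨H, ∂r⟩`, since `∂r` is a Killing field. -/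
lemma Tscal_minner_unitT_er (hg : ∀ i j, ContDiff ℝ (⊤ : ℕ∞) fun x => g x i j)
    (hψ : ContDiff ℝ (⊤ : ℕ∞) ψ) (hgpd : ∀ x, (g x).PosDef) (hψpos : ∀ x, 0 < ψ x)
    {c : ℝ → Fin (n + 1) → ℝ} {x : ℝ} (hc : DifferentiableAt ℝ c x)
    (hT : DifferentiableAt ℝ (unitT (gwL g ψ) c) x) :
    Tscal (gwL g ψ) c (fun y => minner (gwL g ψ (c y)) (unitT (gwL g ψ) c y) (er n)) x
      = minner (gwL g ψ (c x)) (meanCurv (gwL g ψ) c x) (er n) := by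
  have h := hasDerivAt_minner (differentiable_gwL hg hψ) hc.hasDerivAt hT.hasDerivAt
    (hasDerivAt_const x (er n))
  rw [Tscal, h.deriv, minner_meanCurv (posDef_gwL hgpd hψpos) hT, metricDeriv_gwL_er hg hψ]
  simp [minner_eq_dotProduct]

/-- Absorption of the gradient terms in the evolution of the angle function. -/
lemma absorb_gradient_terms {Θ S N a b k p : ℝ} (hΘ : 0 < Θ) (hS : 0 ≤ S) (hN : 0 ≤ N)
    (ha : a ^ 2 ≤ N) (hb : b ^ 2 ≤ N * S) (hk : k ^ 2 ≤ p ^ 2 * S) :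
    S / 2 * Θ - 4 * N * Θ - 4 * N * p ^ 2 / Θ ≤ S * Θ + 2 * b * Θ - 2 * a * k := by
  have h1 : |2 * b| ≤ S / 4 + 4 * N := abs_le_of_sq_le_sq (by
    nlinarith [sq_nonneg (S / 4 - 4 * N)]) (by positivity)
  have hM : 0 ≤ 4 * N * p ^ 2 / Θ := by positivity
  have hMΘ : 4 * N * p ^ 2 / Θ * Θ = 4 * N * p ^ 2 := by field_simp
  have h3 : (a * k) ^ 2 ≤ N * (p ^ 2 * S) := by
    rw [mul_pow]
    exact mul_le_mul ha hk (sq_nonneg _) hN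
  have h2 : |2 * (a * k)| ≤ S * Θ / 4 + 4 * N * p ^ 2 / Θ := by
    set M := 4 * N * p ^ 2 / Θ
    refine abs_le_of_sq_le_sq ?_ (by positivity)
    have : S * Θ * M = 4 * (N * (p ^ 2 * S)) := by linear_combination S * hMΘ
    nlinarith [sq_nonneg (S * Θ / 4 - M)]
  have h1' := mul_le_mul_of_nonneg_right (abs_le.1 h1).1 hΘ.le
  have h2' := (abs_le.1 h2).2
  linarith

end WarpedProduct

/-- The mixed partial derivatives of a smooth two-parameter map, with the common value of the
second ones. -/
lemma exists_mixed_partials {E : Type*} [NormedAddCommGroup E] [NormedSpace ℝ E]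
    {γ : ℝ → ℝ → E} (hγ : ContDiff ℝ (⊤ : ℕ∞) fun q : ℝ × ℝ => γ q.1 q.2) (x t : ℝ) :
    ∃ Z : E, HasDerivAt (fun s => deriv (fun y => γ y s) x) Z t ∧
      HasDerivAt (fun y => deriv (γ y) t) Z x := by
  set F : ℝ × ℝ → E := fun q => γ q.1 q.2 with hF
  have hd : Differentiable ℝ F := hγ.differentiable (by simp)
  have hdd : Differentiable ℝ (fderiv ℝ F) :=
    (hγ.fderiv_right (m := 1) (by
      rw [one_add_one_eq_two]; exact WithTop.coe_le_coe.2 le_top)).differentiable (by simp)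
  have hl : ∀ x s, HasDerivAt (fun y : ℝ => (y, s)) ((1, 0) : ℝ × ℝ) x := fun x s =>
    (hasDerivAt_id x).prodMk (hasDerivAt_const x s)
  have hr : ∀ x s, HasDerivAt (fun s : ℝ => (x, s)) ((0, 1) : ℝ × ℝ) s := fun x s =>
    (hasDerivAt_const s x).prodMk (hasDerivAt_id s)
  have hx : ∀ x s, deriv (fun y => γ y s) x = fderiv ℝ F (x, s) (1, 0) := fun x s =>
    (HasFDerivAt.comp_hasDerivAt (l := F) x (hd (x, s)).hasFDerivAt (hl x s)).deriv
  have ht : ∀ x s, deriv (γ x) s = fderiv ℝ F (x, s) (0, 1) := fun x s =>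
    (HasFDerivAt.comp_hasDerivAt (l := F) s (hd (x, s)).hasFDerivAt (hr x s)).deriv
  have hsymm := second_derivative_symmetric (fun q => (hd q).hasFDerivAt)
    (hdd (x, t)).hasFDerivAt (1, 0) (0, 1)
  refine ⟨fderiv ℝ (fderiv ℝ F) (x, t) (0, 1) (1, 0), ?_, ?_⟩
  · simp only [hx]
    have h := (hdd (x, t)).hasFDerivAt.comp_hasDerivAt t (hr x t)
    simpa using h.clm_apply (hasDerivAt_const t ((1, 0) : ℝ × ℝ))
  · simp only [ht]
    have h := (hdd (x, t)).hasFDerivAt.comp_hasDerivAt x (hl x t)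
    rw [← hsymm]
    simpa using h.clm_apply (hasDerivAt_const x ((0, 1) : ℝ × ℝ))

/-- If `Θ_L > 0` at a point, then
`∂_t Θ_L ≥ ΔΘ_L + (|A|²/2)Θ_L − 4|D(log ψ)|²Θ_L − 4|D(log ψ)|²ψ²/Θ_L`. -/
theorem stmt9 {n : ℕ} (hn : 1 ≤ n)
    (g : (Fin n → ℝ) → Matrix (Fin n) (Fin n) ℝ)
    (hg : ∀ i j, ContDiff ℝ (⊤ : ℕ∞) fun x => g x i j)
    (hgpd : ∀ x, (g x).PosDef)
    (ψ : (Fin n → ℝ) → ℝ) (hψ : ContDiff ℝ (⊤ : ℕ∞) ψ) (hψpos : ∀ x, 0 < ψ x)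
    (t₀ : ℝ) (γ : ℝ → ℝ → Fin (n + 1) → ℝ)
    (hγ : ContDiff ℝ (⊤ : ℕ∞) fun q : ℝ × ℝ => γ q.1 q.2)
    (hreg : ∀ x t, deriv (fun y => γ y t) x ≠ 0)
    (hflow : ∀ x : ℝ, ∀ t ∈ Set.Ico (0 : ℝ) t₀,
      deriv (γ x) t = meanCurv (gwL g ψ) (fun y => γ y t) x)
    (x : ℝ) (t : ℝ) (ht : t ∈ Set.Ico (0 : ℝ) t₀)
    (hΘ : 0 < thetaL g ψ γ x t) :
    deriv (fun s => thetaL g ψ γ x s) t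
      ≥ lapScal (gwL g ψ) (fun y => γ y t) (fun y => thetaL g ψ γ y t) x
        + (minner (gwL g ψ (γ x t)) (meanCurv (gwL g ψ) (fun y => γ y t) x)
            (meanCurv (gwL g ψ) (fun y => γ y t) x) / 2) * thetaL g ψ γ x t
        - 4 * normSqDlogPsi g ψ (fun i => γ x t i.succ) * thetaL g ψ γ x t
        - 4 * normSqDlogPsi g ψ (fun i => γ x t i.succ) * (ψ (fun i => γ x t i.succ)) ^ 2
            / thetaL g ψ γ x t := by
  have hG := differentiable_gwL hg hψ
  have hGp := posDef_gwL hgpd hψpos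
  have hpart : ∀ s, ContDiff ℝ (⊤ : ℕ∞) fun y => γ y s := fun s =>
    hγ.comp (contDiff_id.prodMk contDiff_const)
  have hc : Differentiable ℝ fun y => γ y t := (hpart t).differentiable (by simp)
  have hc' : Differentiable ℝ (deriv fun y => γ y t) :=
    ((contDiff_infty_iff_deriv.1 (hpart t)).2).differentiable (by simp)
  have hT := differentiable_unitT hG hGp hc hc' fun y => hreg y t
  have hγt : HasDerivAt (γ x) (meanCurv (gwL g ψ) (fun y => γ y t) x) t := by
    rw [← hflow x t ht]
    have h : ContDiff ℝ (⊤ : ℕ∞) (γ x) := hγ.comp (contDiff_const.prodMk contDiff_id)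
    exact (h.differentiable (by simp) t).hasDerivAt
  obtain ⟨Z, hV, hH⟩ := exists_mixed_partials hγ x t
  simp only [fun y => hflow y t ht] at hH
  have hspeed := hasDerivAt_speed hG hGp hc hT (fun y => hreg y t) hγt hV hH
  have hvpos := mnorm_pos (hGp (γ x t)) (hreg x t)
  have hψd : ∀ p, HasFDerivAt ψ (fderiv ℝ ψ p) p := fun p =>
    (hψ.differentiable (by simp) p).hasFDerivAt
  have hlap : lapScal (gwL g ψ) (fun y => γ y t) (fun y => thetaL g ψ γ y t) x
      = Tscal (gwL g ψ) (fun y => γ y t) (fun y => ψ (tailCLM n (γ y t)) ^ 2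
          * meanCurv (gwL g ψ) (fun y => γ y t) y 0) x := by
    unfold lapScal
    congr 1
    ext y
    rw [← minner_gwL_er (g := g)]
    exact Tscal_minner_unitT_er hg hψ hgpd hψpos (hc y) (hT y)
  have hψx := ((hψd _).comp_hasDerivAt x
    ((tailCLM n).hasFDerivAt.comp_hasDerivAt x (hc x).hasDerivAt)).pow 2
  have hψt := ((hψd _).comp_hasDerivAt t ((tailCLM n).hasFDerivAt.comp_hasDerivAt t hγt)).pow 2
  have hdx := (hψx.mul (hasDerivAt_pi.1 hH 0)).deriv
  have hdt := (hψt.mul ((hspeed.inv hvpos.ne').mul (hasDerivAt_pi.1 hV 0))).deriv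
  have hθ : ∀ s, thetaL g ψ γ x s = ψ (tailCLM n (γ x s)) ^ 2
      * ((mnorm (gwL g ψ (γ x s)) (deriv (fun y => γ y s) x))⁻¹
        * deriv (fun y => γ y s) x 0) := fun s => by
    rw [thetaL, minner_gwL_er]; rfl
  have hlogT := sq_fderiv_log_le (ψ := ψ) hgpd (γ x t) (unitT (gwL g ψ) (fun y => γ y t) x)
  rw [minner_unitT_self hGp (c := fun y => γ y t) (hreg x t), mul_one] at hlogT
  have hlogH := sq_fderiv_log_le (ψ := ψ) hgpd (γ x t) (meanCurv (gwL g ψ) (fun y => γ y t) x)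
  have hS := (hGp (γ x t)).minner_nonneg (meanCurv (gwL g ψ) (fun y => γ y t) x)
  have hk : (ψ (tailCLM n (γ x t)) ^ 2 * meanCurv (gwL g ψ) (fun y => γ y t) x 0) ^ 2
      ≤ ψ (tailCLM n (γ x t)) ^ 2 * minner (gwL g ψ (γ x t))
        (meanCurv (gwL g ψ) (fun y => γ y t) x) (meanCurv (gwL g ψ) (fun y => γ y t) x) := by
    rw [minner_gwL]
    have := (hgpd (tailCLM n (γ x t))).minner_nonneg
      (tailCLM n (meanCurv (gwL g ψ) (fun y => γ y t) x))
    nlinarith [sq_nonneg (ψ (tailCLM n (γ x t)))]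
  have key := absorb_gradient_terms hΘ hS (normSqDlogPsi_nonneg hgpd (ψ := ψ) _) hlogT hlogH hk
  rw [fderiv_log_apply hψ hψpos, fderiv_log_apply hψ hψpos] at key
  have hunit : tailCLM n (unitT (gwL g ψ) (fun y => γ y t) x)
      = (mnorm (gwL g ψ (γ x t)) (deriv (fun y => γ y t) x))⁻¹
        • tailCLM n (deriv (fun y => γ y t) x) := by
    rw [unitT, map_smul]
  rw [hunit, map_smul, smul_eq_mul] at key
  have hid : deriv (fun s => thetaL g ψ γ x s) t
      = lapScal (gwL g ψ) (fun y => γ y t) (fun y => thetaL g ψ γ y t) x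
        + (minner (gwL g ψ (γ x t)) (meanCurv (gwL g ψ) (fun y => γ y t) x)
            (meanCurv (gwL g ψ) (fun y => γ y t) x) * thetaL g ψ γ x t
          + 2 * ((ψ (tailCLM n (γ x t)))⁻¹ * fderiv ℝ ψ (tailCLM n (γ x t))
              (tailCLM n (meanCurv (gwL g ψ) (fun y => γ y t) x))) * thetaL g ψ γ x t
          - 2 * ((ψ (tailCLM n (γ x t)))⁻¹
              * ((mnorm (gwL g ψ (γ x t)) (deriv (fun y => γ y t) x))⁻¹
                * fderiv ℝ ψ (tailCLM n (γ x t)) (tailCLM n (deriv (fun y => γ y t) x))))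
            * (ψ (tailCLM n (γ x t)) ^ 2 * meanCurv (gwL g ψ) (fun y => γ y t) x 0)) := by
    rw [hlap, Tscal, hθ t, funext hθ]
    refine hdt.trans ?_
    refine Eq.trans ?_ (congrArg (fun d => (mnorm (gwL g ψ (γ x t))
      (deriv (fun y => γ y t) x))⁻¹ * d + _) hdx.symm)
    have hψp := hψpos (tailCLM n (γ x t))
    simp only [Function.comp_apply, Pi.mul_apply, Pi.pow_apply, Pi.inv_apply]
    field_simp
    ring
  rw [hid]
  change _ ≥ lapScal (gwL g ψ) (fun y => γ y t) (fun y => thetaL g ψ γ y t) x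
        + (minner (gwL g ψ (γ x t)) (meanCurv (gwL g ψ) (fun y => γ y t) x)
            (meanCurv (gwL g ψ) (fun y => γ y t) x) / 2) * thetaL g ψ γ x t
        - 4 * normSqDlogPsi g ψ (tailCLM n (γ x t)) * thetaL g ψ γ x t
        - 4 * normSqDlogPsi g ψ (tailCLM n (γ x t)) * (ψ (tailCLM n (γ x t))) ^ 2
            / thetaL g ψ γ x t
  linarith

end
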